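/- For any ξ ∈ F_q((T^{-1})) and any positive integer n, w_n(ξ) = w_n(ξ^p), where p is the characteristic. -/

import Mathlib

open Polynomial
open scoped Classical

namespace MahlerKoksmaFq

noncomputable section

variable (Fq : Type) [Field Fq] [Fintype Fq]

/-- `K Fq` models `F_q((T⁻¹))`: Laurent series in the variable `t = T⁻¹`. -/
abbrev K := LaurentSeries Fq

/-- The element `T` (the inverse of the Laurent-series variable `t = T⁻¹`). -/
def Tvar : K Fq := HahnSeries.single (-1 : ℤ) 1

/-- The absolute value `|ξ| = q^{-ν(ξ)}` on `F_q((T⁻¹))`. -/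
def absK (ξ : K Fq) : ℝ :=
  if ξ = 0 then 0 else (Fintype.card Fq : ℝ) ^ (-(HahnSeries.order ξ))

/-- The embedding of `F_q[T]` into `F_q((T⁻¹))`, sending `T` to `Tvar`. -/
def emb : Polynomial Fq →+* K Fq :=
  Polynomial.eval₂RingHom (algebraMap Fq (K Fq)) (Tvar Fq)

/-- Evaluation of `P ∈ F_q[T][X]` at `ξ ∈ F_q((T⁻¹))`. -/
def evalK (P : Polynomial (Polynomial Fq)) (ξ : K Fq) : K Fq :=
  P.eval₂ (emb Fq) ξ

/-- Height of a polynomial over `F_q[T]`: the maximum of the absolute values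
`q^{deg c}` of its coefficients. -/
def HP (P : Polynomial (Polynomial Fq)) : ℝ :=
  (Fintype.card Fq : ℝ) ^ (P.support.sup fun i => (P.coeff i).natDegree)

/-- `ξ` is algebraic (over `F_q[T]`) of degree at most `n`. -/
def IsAlgDegLe (ξ : K Fq) (n : ℕ) : Prop :=
  ∃ P : Polynomial (Polynomial Fq), P ≠ 0 ∧ P.natDegree ≤ n ∧ evalK Fq P ξ = 0

/-- `ξ` is algebraic over `F_q[T]`. -/
def IsAlgK (ξ : K Fq) : Prop :=
  ∃ P : Polynomial (Polynomial Fq), P ≠ 0 ∧ evalK Fq P ξ = 0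

/-- The degree of an algebraic element of `F_q((T⁻¹))`. -/
def degA (α : K Fq) : ℕ :=
  sInf {d | ∃ P : Polynomial (Polynomial Fq), P ≠ 0 ∧ P.natDegree = d ∧ evalK Fq P α = 0}

/-- The height of an algebraic element `α` of `F_q((T⁻¹))`: the least height of a
 nonzero annihilating polynomial of minimal degree (= height of the minimal
 defining polynomial over `F_q[T]`). -/
def HA (α : K Fq) : ℝ :=
  sInf {h | ∃ P : Polynomial (Polynomial Fq),
    P ≠ 0 ∧ P.natDegree = degA Fq α ∧ evalK Fq P α = 0 ∧ h = HP Fq P}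

/-- The defining set for Mahler's exponent `w_n`. -/
def wnSet (ξ : K Fq) (n : ℕ) : Set ℝ :=
  {w | {P : Polynomial (Polynomial Fq) |
      P.natDegree ≤ n ∧ 0 < absK Fq (evalK Fq P ξ) ∧
      absK Fq (evalK Fq P ξ) < HP Fq P ^ (-w)}.Infinite}

/-- Mahler's exponent `w_n(ξ)`. -/
def wn (ξ : K Fq) (n : ℕ) : EReal :=
  sSup ((fun w : ℝ => (w : EReal)) '' wnSet Fq ξ n)

/-- The defining set for `w_n^{sep}` (separable polynomials only). -/
def wnsepSet (ξ : K Fq) (n : ℕ) : Set ℝ :=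
  {w | {P : Polynomial (Polynomial Fq) |
      P.Separable ∧ P.natDegree ≤ n ∧ 0 < absK Fq (evalK Fq P ξ) ∧
      absK Fq (evalK Fq P ξ) < HP Fq P ^ (-w)}.Infinite}

/-- The exponent `w_n^{sep}(ξ)`. -/
def wnsep (ξ : K Fq) (n : ℕ) : EReal :=
  sSup ((fun w : ℝ => (w : EReal)) '' wnsepSet Fq ξ n)

/-- The defining set for Koksma's exponent `w_n^*` (approximation by algebraic
elements lying in `F_q((T⁻¹))`). -/
def wnstarSet (ξ : K Fq) (n : ℕ) : Set ℝ :=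
  {w | {α : K Fq | IsAlgK Fq α ∧ degA Fq α ≤ n ∧ 0 < absK Fq (ξ - α) ∧
      absK Fq (ξ - α) < HA Fq α ^ (-w - 1)}.Infinite}

/-- Koksma's exponent `w_n^*(ξ)`. -/
def wnstar (ξ : K Fq) (n : ℕ) : EReal :=
  sSup ((fun w : ℝ => (w : EReal)) '' wnstarSet Fq ξ n)

/-- The defining set for the uniform exponent `ŵ_n`. -/
def hwnSet (ξ : K Fq) (n : ℕ) : Set ℝ :=
  {w | ∃ H0 : ℝ, ∀ H : ℝ, H0 < H → ∃ P : Polynomial (Polynomial Fq),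
      P.natDegree ≤ n ∧ HP Fq P ≤ H ∧ 0 < absK Fq (evalK Fq P ξ) ∧
      absK Fq (evalK Fq P ξ) < H ^ (-w)}

/-- The uniform exponent `ŵ_n(ξ)`. -/
def hwn (ξ : K Fq) (n : ℕ) : EReal :=
  sSup ((fun w : ℝ => (w : EReal)) '' hwnSet Fq ξ n)

/-- The defining set for the uniform exponent `ŵ_n^{sep}` (separable polynomials only). -/
def hwnsepSet (ξ : K Fq) (n : ℕ) : Set ℝ :=
  {w | ∃ H0 : ℝ, ∀ H : ℝ, H0 < H → ∃ P : Polynomial (Polynomial Fq),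
      P.Separable ∧ P.natDegree ≤ n ∧ HP Fq P ≤ H ∧ 0 < absK Fq (evalK Fq P ξ) ∧
      absK Fq (evalK Fq P ξ) < H ^ (-w)}

/-- The uniform exponent `ŵ_n^{sep}(ξ)`. -/
def hwnsep (ξ : K Fq) (n : ℕ) : EReal :=
  sSup ((fun w : ℝ => (w : EReal)) '' hwnsepSet Fq ξ n)

/-- The fractional part of a Laurent series in `T⁻¹`: the part with only
 negative powers of `T` (positive powers of the series variable `t = T⁻¹`). -/
def fracPart (η : K Fq) : K Fq :=
  { coeff := fun m => if 0 < m then η.coeff m else 0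
    isPWO_support' := η.isPWO_support'.mono (fun m hm => by
      by_cases h : 0 < m
      · simpa [Function.mem_support, h] using hm
      · simp [Function.mem_support, h] at hm) }

/-- The fractional-part norm `‖η‖ = |η - [η]|`. -/
def fracNorm (η : K Fq) : ℝ := absK Fq (fracPart Fq η)

/-- `max{‖R(T)ξ‖, …, ‖R(T)ξⁿ‖}`. -/
def maxFrac (ξ : K Fq) (n : ℕ) (R : Polynomial Fq) : ℝ :=
  sSup ((fun i => fracNorm Fq (emb Fq R * ξ ^ i)) '' Set.Icc 1 n)

/-- The defining set for the exponent of simultaneous approximation `λ_n`. -/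
def lamSet (ξ : K Fq) (n : ℕ) : Set ℝ :=
  {l | {R : Polynomial Fq | 0 < maxFrac Fq ξ n R ∧
      maxFrac Fq ξ n R < (Fintype.card Fq : ℝ) ^ (-(l * R.natDegree))}.Infinite}

/-- The exponent of simultaneous approximation `λ_n(ξ)`. -/
def lam (ξ : K Fq) (n : ℕ) : EReal :=
  sSup ((fun w : ℝ => (w : EReal)) '' lamSet Fq ξ n)

/-- The defining set for the uniform exponent `λ̂_n`. -/
def hlamSet (ξ : K Fq) (n : ℕ) : Set ℝ :=
  {l | ∃ d0 : ℕ, ∀ d : ℕ, d0 < d → ∃ R : Polynomial Fq, R.natDegree ≤ d ∧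
      0 < maxFrac Fq ξ n R ∧
      maxFrac Fq ξ n R < (Fintype.card Fq : ℝ) ^ (-(l * d))}

/-- The uniform exponent `λ̂_n(ξ)`. -/
def hlam (ξ : K Fq) (n : ℕ) : EReal :=
  sSup ((fun w : ℝ => (w : EReal)) '' hlamSet Fq ξ n)

/-- An algebraic closure of `F_q((T⁻¹))`; its algebraic elements are exactly the
algebraic elements of the completion `C_∞`. -/
abbrev Kbar := AlgebraicClosure (K Fq)

/-- The embedding of `F_q[T]` into the algebraic closure. -/
def embbar : Polynomial Fq →+* Kbar Fq :=
  (algebraMap (K Fq) (Kbar Fq)).comp (emb Fq)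

/-- Evaluation of `P ∈ F_q[T][X]` at a point of the algebraic closure. -/
def evalKbar (P : Polynomial (Polynomial Fq)) (x : Kbar Fq) : Kbar Fq :=
  P.eval₂ (embbar Fq) x

/-- The unique extension of the absolute value of `F_q((T⁻¹))` to its algebraic
closure: `|x| = |N(x)|^{1/d} = |a_0|^{1/d}` where `a_0` is the constant term and
`d` the degree of the minimal polynomial of `x` over `F_q((T⁻¹))`. -/
def absC (x : Kbar Fq) : ℝ :=
  absK Fq ((minpoly (K Fq) x).coeff 0) ^ ((1 : ℝ) / (minpoly (K Fq) x).natDegree)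

/-- `x ∈ C_∞` is algebraic over `F_q[T]`. -/
def IsAlgKbar (x : Kbar Fq) : Prop :=
  ∃ P : Polynomial (Polynomial Fq), P ≠ 0 ∧ evalKbar Fq P x = 0

/-- Degree over `F_q[T]` of an algebraic element of `C_∞`. -/
def degAbar (x : Kbar Fq) : ℕ :=
  sInf {d | ∃ P : Polynomial (Polynomial Fq), P ≠ 0 ∧ P.natDegree = d ∧ evalKbar Fq P x = 0}

/-- Height of an algebraic element of `C_∞`. -/
def HAbar (x : Kbar Fq) : ℝ :=
  sInf {h | ∃ P : Polynomial (Polynomial Fq),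
    P ≠ 0 ∧ P.natDegree = degAbar Fq x ∧ evalKbar Fq P x = 0 ∧ h = HP Fq P}

/-- The defining set for the exponent `w_n^@` (approximation by algebraic
elements of `C_∞`). -/
def wnAtSet (ξ : K Fq) (n : ℕ) : Set ℝ :=
  {w | {α : Kbar Fq | IsAlgKbar Fq α ∧ degAbar Fq α ≤ n ∧
      0 < absC Fq (algebraMap (K Fq) (Kbar Fq) ξ - α) ∧
      absC Fq (algebraMap (K Fq) (Kbar Fq) ξ - α) < HAbar Fq α ^ (-w - 1)}.Infinite}

/-- The exponent `w_n^@(ξ)`. -/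
def wnAt (ξ : K Fq) (n : ℕ) : EReal :=
  sSup ((fun w : ℝ => (w : EReal)) '' wnAtSet Fq ξ n)

/-- The defining set for the uniform exponent `ŵ_n^@`. -/
def hwnAtSet (ξ : K Fq) (n : ℕ) : Set ℝ :=
  {w | ∃ H0 : ℝ, ∀ H : ℝ, H0 < H → ∃ α : Kbar Fq, IsAlgKbar Fq α ∧ degAbar Fq α ≤ n ∧
      HAbar Fq α ≤ H ∧ 0 < absC Fq (algebraMap (K Fq) (Kbar Fq) ξ - α) ∧
      absC Fq (algebraMap (K Fq) (Kbar Fq) ξ - α) < (HAbar Fq α)⁻¹ * H ^ (-w)}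

/-- The uniform exponent `ŵ_n^@(ξ)`. -/
def hwnAt (ξ : K Fq) (n : ℕ) : EReal :=
  sSup ((fun w : ℝ => (w : EReal)) '' hwnAtSet Fq ξ n)

/-- `w(ξ) = limsup_n w_n(ξ)/n`. -/
def wlim (ξ : K Fq) : EReal :=
  Filter.atTop.limsup fun n : ℕ => wn Fq ξ n * (((n : ℝ)⁻¹ : ℝ) : EReal)

/-- `w^*(ξ) = limsup_n w_n^*(ξ)/n`. -/
def wlimstar (ξ : K Fq) : EReal :=
  Filter.atTop.limsup fun n : ℕ => wnstar Fq ξ n * (((n : ℝ)⁻¹ : ℝ) : EReal)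

/-- Height of a polynomial over `C_∞`: maximum of the absolute values of its
coefficients. -/
def HC (P : Polynomial (Kbar Fq)) : ℝ :=
  sSup ((fun i => absC Fq (P.coeff i)) '' Set.Iic P.natDegree)


lemma card_gt_one (Fq : Type) [Field Fq] [Fintype Fq] : (1 : ℝ) < (Fintype.card Fq : ℝ) := by
  exact_mod_cast Fintype.one_lt_card

/-- Logarithmic height. -/
def lh (Fq : Type) [Field Fq] (P : Polynomial (Polynomial Fq)) : ℕ :=
  P.support.sup fun i => (P.coeff i).natDegree

lemma HP_eq (Fq : Type) [Field Fq] [Fintype Fq] (P : Polynomial (Polynomial Fq)) :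
    HP Fq P = (Fintype.card Fq : ℝ) ^ (lh Fq P) := rfl

lemma le_lh (Fq : Type) [Field Fq] (P : Polynomial (Polynomial Fq)) (i : ℕ) :
    (P.coeff i).natDegree ≤ lh Fq P := by
  by_cases h : i ∈ P.support
  · exact Finset.le_sup (f := fun i => (P.coeff i).natDegree) h
  · rw [Polynomial.notMem_support_iff.mp h]; simp

lemma lh_le (Fq : Type) [Field Fq] (P : Polynomial (Polynomial Fq)) (d : ℕ)
    (h : ∀ i, (P.coeff i).natDegree ≤ d) : lh Fq P ≤ d :=
  Finset.sup_le fun i _ => h i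

lemma one_le_HP (Fq : Type) [Field Fq] [Fintype Fq] (P : Polynomial (Polynomial Fq)) :
    1 ≤ HP Fq P := by
  rw [HP_eq]; exact one_le_pow₀ (card_gt_one Fq).le

lemma absK_pos_iff (Fq : Type) [Field Fq] [Fintype Fq] (x : K Fq) : 0 < absK Fq x ↔ x ≠ 0 := by
  unfold absK
  have := card_gt_one Fq
  split_ifs with h
  · simp [h]
  · simp only [ne_eq, h, not_false_eq_true, iff_true]; positivity

lemma absK_pow (Fq : Type) [Field Fq] [Fintype Fq] (x : K Fq) (p : ℕ) (hp : p ≠ 0) :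
    absK Fq (x ^ p) = absK Fq x ^ p := by
  unfold absK
  by_cases h : x = 0
  · simp [h, hp]
  · rw [if_neg h, if_neg (pow_ne_zero _ h), HahnSeries.order_pow, ← zpow_natCast, ← zpow_mul]
    congr 1
    simp; ring

/-- Finiteness of the set of polynomials with coefficients in a finite set. -/
lemma finite_polys {R : Type} [Semiring R] (S : Set R) (hS : S.Finite) (n : ℕ) :
    {P : Polynomial R | P.natDegree ≤ n ∧ ∀ i, P.coeff i ∈ S}.Finite := by
  have hf : (Set.pi Set.univ (fun _ : Fin (n + 1) => S)).Finite := Set.Finite.pi fun _ => hS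
  refine Set.Finite.of_finite_image (f := fun P (i : Fin (n + 1)) => P.coeff i)
    (hf.subset ?_) ?_
  · rintro _ ⟨P, hP, rfl⟩ i _
    exact hP.2 _
  · intro P hP Q hQ h
    ext1 i
    by_cases hi : i < n + 1
    · exact congrFun h ⟨i, hi⟩
    · rw [Polynomial.coeff_eq_zero_of_natDegree_lt (lt_of_le_of_lt hP.1 (by omega)),
        Polynomial.coeff_eq_zero_of_natDegree_lt (lt_of_le_of_lt hQ.1 (by omega))]

lemma finite_lh (Fq : Type) [Field Fq] [Fintype Fq] (n d : ℕ) :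
    {P : Polynomial (Polynomial Fq) | P.natDegree ≤ n ∧ lh Fq P ≤ d}.Finite := by
  have h1 : {a : Polynomial Fq | a.natDegree ≤ d ∧ ∀ i, a.coeff i ∈ (Set.univ : Set Fq)}.Finite :=
    finite_polys _ Set.finite_univ d
  refine (finite_polys _ h1 n).subset ?_
  rintro P ⟨h, h'⟩
  exact ⟨h, fun i => ⟨(le_lh Fq P i).trans h', fun _ => Set.mem_univ _⟩⟩

lemma emb_monomial (Fq : Type) [Field Fq] (m : ℕ) (c : Fq) :
    emb Fq (Polynomial.monomial m c) = HahnSeries.single (-(m : ℤ)) c := by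
  simp only [emb, Polynomial.coe_eval₂RingHom, Polynomial.eval₂_monomial, Tvar,
    HahnSeries.single_pow]
  rw [LaurentSeries.algebraMap_apply, HahnSeries.C_apply, HahnSeries.single_mul_single]
  simp

/-- Integer part. -/
lemma exists_intPart (Fq : Type) [Field Fq] (m : ℕ) : ∀ η : K Fq,
    (∀ k : ℤ, k < -m → η.coeff k = 0) →
    ∃ b : Polynomial Fq, ∀ k : ℤ, k < 0 → (η - emb Fq b).coeff k = 0 := by
  induction m with
  | zero => intro η h; exact ⟨0, by simpa using h⟩
  | succ m ih =>
    intro η h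
    obtain ⟨b, hb⟩ := ih (η - emb Fq (Polynomial.monomial (m + 1) (η.coeff (-((m + 1 : ℕ) : ℤ)))))
      (by
        intro k hk
        rw [emb_monomial, HahnSeries.coeff_sub, HahnSeries.coeff_single]
        split_ifs with h2
        · rw [h2]; simp
        · rw [h k (by push_cast at *; omega)]; simp)
    refine ⟨Polynomial.monomial (m + 1) (η.coeff (-((m + 1 : ℕ) : ℤ))) + b, fun k hk => ?_⟩
    rw [map_add, ← sub_sub]
    exact hb k hk

lemma exists_small (Fq : Type) [Field Fq] (η : K Fq) :
    ∃ b : Polynomial Fq, η + emb Fq b ≠ 0 ∧ 0 ≤ (η + emb Fq b).order := by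
  obtain ⟨b, hb⟩ := exists_intPart Fq (-η.order).toNat η (by
    intro k hk
    apply HahnSeries.coeff_eq_zero_of_lt_order
    omega)
  have key : ∀ x : K Fq, x ≠ 0 → (∀ k : ℤ, k < 0 → x.coeff k = 0) → 0 ≤ x.order := by
    intro x hx h
    by_contra hc
    exact HahnSeries.coeff_order_eq_zero.not.mpr hx (h _ (not_le.mp hc))
  by_cases h : η - emb Fq b = 0
  · refine ⟨-b + 1, ?_, ?_⟩
    · rw [map_add, map_neg, map_one, ← add_assoc, ← sub_eq_add_neg, h]; simp
    · rw [map_add, map_neg, map_one, ← add_assoc, ← sub_eq_add_neg, h]; simp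
  · refine ⟨-b, ?_⟩
    rw [map_neg, ← sub_eq_add_neg]
    exact ⟨h, key _ h hb⟩

lemma neg_mem_wnSet (Fq : Type) [Field Fq] [Fintype Fq] (ξ : K Fq) (n : ℕ) (hn : 1 ≤ n)
    (w : ℝ) (hw : w < 0) : w ∈ wnSet Fq ξ n := by
  have hb : ∀ m : ℕ, ∃ b : Polynomial Fq, emb Fq (X ^ (m + 1)) * ξ + emb Fq b ≠ 0 ∧
    0 ≤ (emb Fq (X ^ (m + 1)) * ξ + emb Fq b).order := fun m => exists_small Fq _
  choose b hb0 hb1 using hb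
  have hq := card_gt_one Fq
  let f : ℕ → Polynomial (Polynomial Fq) := fun m => C (X ^ (m + 1)) * X + C (b m)
  have hc : ∀ m, (f m).coeff 1 = X ^ (m + 1) := by
    intro m; simp [f, Polynomial.coeff_C, -map_pow]
  have hev : ∀ m, evalK Fq (f m) ξ = emb Fq (X ^ (m + 1)) * ξ + emb Fq (b m) := by
    intro m; simp [f, evalK, -map_pow]
  have hinj : Function.Injective f := by
    intro m m' h
    have := congrArg (fun P => (P.coeff 1).natDegree) h
    simpa [hc] using this
  refine (Set.infinite_range_of_injective hinj).mono ?_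
  rintro _ ⟨m, rfl⟩
  refine ⟨(Polynomial.natDegree_linear_le).trans hn, ?_, ?_⟩
  · rw [absK_pos_iff, hev]; exact hb0 m
  · have h1 : absK Fq (evalK Fq (f m) ξ) ≤ 1 := by
      rw [hev, absK, if_neg (hb0 m)]
      exact zpow_le_one_of_nonpos₀ hq.le (by have := hb1 m; omega)
    refine h1.trans_lt (Real.one_lt_rpow ?_ (by linarith))
    rw [HP_eq]
    refine one_lt_pow₀ hq ?_
    have := le_lh Fq (f m) 1
    rw [hc] at this
    simp at this
    omega

/-- The `j`-th `p`-section of a polynomial. -/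
def sec (p : ℕ) [Fact p.Prime] (Fq : Type) [Field Fq] [Fintype Fq] [CharP Fq p] (j : ℕ)
    (a : Polynomial Fq) : Polynomial Fq :=
  ∑ k ∈ Finset.range (a.natDegree + 1),
    Polynomial.monomial k ((frobeniusEquiv Fq p).symm (a.coeff (p * k + j)))

lemma coeff_sec (p : ℕ) [Fact p.Prime] (Fq : Type) [Field Fq] [Fintype Fq] [CharP Fq p] (j : ℕ)
    (a : Polynomial Fq) (k : ℕ) :
    (sec p Fq j a).coeff k = (frobeniusEquiv Fq p).symm (a.coeff (p * k + j)) := by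
  have hp : 0 < p := (Fact.out : p.Prime).pos
  simp only [sec, Polynomial.finsetSum_coeff, Polynomial.coeff_monomial, Finset.sum_ite_eq',
    Finset.mem_range]
  split_ifs with h
  · rfl
  · rw [Polynomial.coeff_eq_zero_of_natDegree_lt (by nlinarith), map_zero]

lemma sec_natDegree (p : ℕ) [Fact p.Prime] (Fq : Type) [Field Fq] [Fintype Fq] [CharP Fq p]
    (j : ℕ) (a : Polynomial Fq) : (sec p Fq j a).natDegree ≤ a.natDegree / p := by
  have hp : 0 < p := (Fact.out : p.Prime).pos
  rw [Polynomial.natDegree_le_iff_coeff_eq_zero]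
  intro k hk
  rw [Nat.div_lt_iff_lt_mul hp] at hk
  rw [coeff_sec, Polynomial.coeff_eq_zero_of_natDegree_lt (by nlinarith), map_zero]

lemma sec_zero (p : ℕ) [Fact p.Prime] (Fq : Type) [Field Fq] [Fintype Fq] [CharP Fq p]
    (j : ℕ) : sec p Fq j 0 = 0 := by
  ext k; simp [coeff_sec]

lemma sec_sum (p : ℕ) [Fact p.Prime] (Fq : Type) [Field Fq] [Fintype Fq] [CharP Fq p]
    (a : Polynomial Fq) : a = ∑ j ∈ Finset.range p, X ^ j * (sec p Fq j a) ^ p := by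
  have hp : 0 < p := (Fact.out : p.Prime).pos
  ext m
  simp only [← Polynomial.map_frobenius_expand, Polynomial.finsetSum_coeff, Polynomial.coeff_X_pow_mul',
    Polynomial.map_expand, Polynomial.coeff_expand hp, Polynomial.coeff_map, coeff_sec]
  rw [Finset.sum_eq_single (m % p)]
  · rw [if_pos (Nat.mod_le _ _), if_pos (Nat.dvd_sub_mod m),
      Nat.mul_div_cancel' (Nat.dvd_sub_mod m), Nat.sub_add_cancel (Nat.mod_le _ _)]
    simp
  · intro j hj hne
    rw [Finset.mem_range] at hj
    split_ifs with h1 h2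
    · exfalso
      apply hne
      obtain ⟨c, hc⟩ := h2
      have : m = j + p * c := by omega
      rw [this, Nat.add_mul_mod_self_left, Nat.mod_eq_of_lt hj]
    · rfl
    · rfl
  · intro h
    exact absurd (Finset.mem_range.mpr (Nat.mod_lt _ hp)) h

/-- Coefficientwise section. -/
def secP (p : ℕ) [Fact p.Prime] (Fq : Type) [Field Fq] [Fintype Fq] [CharP Fq p] (j : ℕ)
    (P : Polynomial (Polynomial Fq)) : Polynomial (Polynomial Fq) :=
  ∑ i ∈ Finset.range (P.natDegree + 1), Polynomial.monomial i (sec p Fq j (P.coeff i))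

lemma coeff_secP (p : ℕ) [Fact p.Prime] (Fq : Type) [Field Fq] [Fintype Fq] [CharP Fq p] (j : ℕ)
    (P : Polynomial (Polynomial Fq)) (i : ℕ) :
    (secP p Fq j P).coeff i = sec p Fq j (P.coeff i) := by
  simp only [secP, Polynomial.finsetSum_coeff, Polynomial.coeff_monomial, Finset.sum_ite_eq',
    Finset.mem_range]
  split_ifs with h
  · rfl
  · rw [Polynomial.coeff_eq_zero_of_natDegree_lt (by omega), sec_zero]

lemma secP_natDegree (p : ℕ) [Fact p.Prime] (Fq : Type) [Field Fq] [Fintype Fq] [CharP Fq p]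
    (j : ℕ) (P : Polynomial (Polynomial Fq)) : (secP p Fq j P).natDegree ≤ P.natDegree := by
  rw [Polynomial.natDegree_le_iff_coeff_eq_zero]
  intro k hk
  rw [coeff_secP, Polynomial.coeff_eq_zero_of_natDegree_lt hk, sec_zero]

lemma secP_lh (p : ℕ) [Fact p.Prime] (Fq : Type) [Field Fq] [Fintype Fq] [CharP Fq p]
    (j : ℕ) (P : Polynomial (Polynomial Fq)) : lh Fq (secP p Fq j P) * p ≤ lh Fq P := by
  have hp : 0 < p := (Fact.out : p.Prime).pos
  rw [← Nat.le_div_iff_mul_le hp]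
  apply lh_le
  intro i
  rw [coeff_secP]
  exact (sec_natDegree p Fq j _).trans (Nat.div_le_div_right (le_lh Fq P i))

lemma charP_K (p : ℕ) (Fq : Type) [Field Fq] [CharP Fq p] : CharP (K Fq) p :=
  charP_of_injective_algebraMap (algebraMap Fq (K Fq)).injective p

lemma evalK_secP (p : ℕ) [Fact p.Prime] (Fq : Type) [Field Fq] [Fintype Fq] [CharP Fq p]
    (P : Polynomial (Polynomial Fq)) (ξ : K Fq) :
    evalK Fq P (ξ ^ p) =
      ∑ j ∈ Finset.range p, HahnSeries.single (-(j : ℤ)) 1 * evalK Fq (secP p Fq j P) ξ ^ p := by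
  have := charP_K p Fq
  have hX : ∀ j : ℕ, emb Fq (X ^ j) = HahnSeries.single (-(j : ℤ)) 1 := by
    intro j
    rw [← emb_monomial, Polynomial.monomial_one_right_eq_X_pow]
  have h1 : ∀ j, evalK Fq (secP p Fq j P) ξ =
      ∑ i ∈ Finset.range (P.natDegree + 1), emb Fq (sec p Fq j (P.coeff i)) * ξ ^ i := by
    intro j
    rw [evalK, Polynomial.eval₂_eq_sum_range' _
      (Nat.lt_succ_of_le (secP_natDegree p Fq j P))]
    simp only [coeff_secP]
  simp only [h1, sum_pow_char, ← hX]
  rw [evalK, Polynomial.eval₂_eq_sum_range]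
  simp only [Finset.mul_sum]
  rw [Finset.sum_comm]
  refine Finset.sum_congr rfl fun i _ => ?_
  conv_lhs => rw [sec_sum p Fq (P.coeff i)]
  rw [map_sum, Finset.sum_mul]
  refine Finset.sum_congr rfl fun j _ => ?_
  rw [map_mul, map_pow (emb Fq) (sec p Fq j (P.coeff i)) p]
  ring

lemma exists_dominant (p : ℕ) (Fq : Type) [Field Fq] [Fintype Fq]
    (f : ℕ → K Fq) (η : K Fq)
    (h : η = ∑ j ∈ Finset.range p, HahnSeries.single (-(j : ℤ)) 1 * f j ^ p) (hη : η ≠ 0) :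
    ∃ j, f j ≠ 0 ∧ η.order ≤ p * (f j).order := by
  have hord : ∀ j, f j ≠ 0 →
      (HahnSeries.single (-(j : ℤ)) (1 : Fq) * f j ^ p).order = -(j : ℤ) + p * (f j).order := by
    intro j hj
    rw [HahnSeries.order_mul (by simp) (pow_ne_zero _ hj), HahnSeries.order_single one_ne_zero,
      HahnSeries.order_pow]
    simp
  let s := (Finset.range p).filter fun j => f j ≠ 0
  have hs : s.Nonempty := by
    by_contra hc
    rw [Finset.not_nonempty_iff_eq_empty] at hc
    apply hη
    rw [h]
    refine Finset.sum_eq_zero fun j hj => ?_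
    have : j ∉ s := by rw [hc]; simp
    have h0 : f j = 0 := by
      by_contra h0
      exact this (Finset.mem_filter.mpr ⟨hj, h0⟩)
    have hp : p ≠ 0 := by rintro rfl; simp at hj
    rw [h0, zero_pow hp, mul_zero]
  obtain ⟨j, hj, hmin⟩ := Finset.exists_min_image s
    (fun j => -(j : ℤ) + p * (f j).order) hs
  obtain ⟨hjp, hj0⟩ := Finset.mem_filter.mp hj
  refine ⟨j, hj0, ?_⟩
  have hle : η.order ≤ -(j : ℤ) + p * (f j).order := by
    apply HahnSeries.order_le_of_coeff_ne_zero
    rw [h, HahnSeries.coeff_sum, Finset.sum_eq_single j]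
    · rw [← hord j hj0, Ne, HahnSeries.coeff_order_eq_zero]
      exact mul_ne_zero (by simp) (pow_ne_zero _ hj0)
    · intro i hi hij
      by_cases h0 : f i = 0
      · have hp : p ≠ 0 := by rintro rfl; simp at hi
        simp [h0, hp]
      · apply HahnSeries.coeff_eq_zero_of_lt_order
        rw [hord i h0]
        refine lt_of_le_of_ne (hmin i (Finset.mem_filter.mpr ⟨hi, h0⟩)) ?_
        intro he
        apply hij
        rw [Finset.mem_range] at hi hjp
        have hd : (p : ℤ) ∣ (i : ℤ) - j := ⟨(f i).order - (f j).order, by linarith⟩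
        have := Int.eq_zero_of_abs_lt_dvd hd (by rw [abs_lt]; constructor <;> omega)
        omega
    · intro hc; exact absurd hjp hc
  omega

lemma exists_sec (p : ℕ) [Fact p.Prime] (Fq : Type) [Field Fq] [Fintype Fq] [CharP Fq p]
    (P : Polynomial (Polynomial Fq)) (ξ : K Fq) (h : evalK Fq P (ξ ^ p) ≠ 0) :
    ∃ Q : Polynomial (Polynomial Fq), Q.natDegree ≤ P.natDegree ∧ HP Fq Q ^ p ≤ HP Fq P ∧
      evalK Fq Q ξ ≠ 0 ∧ absK Fq (evalK Fq Q ξ) ^ p ≤ absK Fq (evalK Fq P (ξ ^ p)) := by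
  obtain ⟨j, hj0, hj⟩ := exists_dominant p Fq (fun j => evalK Fq (secP p Fq j P) ξ) _
    (evalK_secP p Fq P ξ) h
  have hq := card_gt_one Fq
  refine ⟨secP p Fq j P, secP_natDegree p Fq j P, ?_, hj0, ?_⟩
  · rw [HP_eq, HP_eq, ← pow_mul]
    exact pow_le_pow_right₀ hq.le (secP_lh p Fq j P)
  · rw [← absK_pow _ _ _ (Fact.out : p.Prime).ne_zero, absK, absK,
      if_neg (pow_ne_zero _ hj0), if_neg h]
    apply zpow_le_zpow_right₀ hq.le
    rw [HahnSeries.order_pow]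
    simpa using hj

lemma evalK_frob (p : ℕ) [Fact p.Prime] (Fq : Type) [Field Fq] [CharP Fq p]
    (P : Polynomial (Polynomial Fq)) (ξ : K Fq) :
    evalK Fq (P.map (frobenius (Polynomial Fq) p)) (ξ ^ p) = evalK Fq P ξ ^ p := by
  have := charP_K p Fq
  rw [evalK, evalK, Polynomial.eval₂_map, ← frobenius_def, ← frobenius_def, Polynomial.hom_eval₂]
  congr 1
  ext x <;> simp [frobenius_def]

lemma mem_frob (p : ℕ) [Fact p.Prime] (Fq : Type) [Field Fq] [Fintype Fq] [CharP Fq p]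
    (ξ : K Fq) (n : ℕ) (w : ℝ) (hw : 0 < w) (h : w ∈ wnSet Fq ξ n) :
    w ∈ wnSet Fq (ξ ^ p) n := by
  have hp0 : p ≠ 0 := (Fact.out : p.Prime).ne_zero
  have hq := card_gt_one Fq
  have hinj : Function.Injective
      (Polynomial.map (frobenius (Polynomial Fq) p)) :=
    Polynomial.map_injective _ (frobenius_inj _ p)
  refine (Set.Infinite.image hinj.injOn h).mono ?_
  rintro _ ⟨P, ⟨h1, h2, h3⟩, rfl⟩
  refine ⟨Polynomial.natDegree_map_le.trans h1, ?_, ?_⟩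
  · rw [evalK_frob, absK_pow _ _ _ hp0]; positivity
  · rw [evalK_frob, absK_pow _ _ _ hp0]
    have hH : HP Fq (P.map (frobenius (Polynomial Fq) p)) ≤ HP Fq P ^ p := by
      rw [HP_eq, HP_eq, ← pow_mul]
      refine pow_le_pow_right₀ hq.le (lh_le _ _ _ fun i => ?_)
      rw [Polynomial.coeff_map, frobenius_def, Polynomial.natDegree_pow, mul_comm]
      exact Nat.mul_le_mul_right _ (le_lh Fq P i)
    have hpos : 0 < HP Fq P := zero_lt_one.trans_le (one_le_HP Fq P)
    calc absK Fq (evalK Fq P ξ) ^ p < (HP Fq P ^ (-w)) ^ p := pow_lt_pow_left₀ h3 h2.le hp0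
      _ = (HP Fq P ^ p) ^ (-w) := by
        rw [← Real.rpow_natCast, ← Real.rpow_natCast, ← Real.rpow_mul hpos.le,
          ← Real.rpow_mul hpos.le, mul_comm]
      _ ≤ _ := Real.rpow_le_rpow_of_nonpos
        (zero_lt_one.trans_le (one_le_HP Fq _)) hH (by linarith)

lemma mem_of_frob (p : ℕ) [Fact p.Prime] (Fq : Type) [Field Fq] [Fintype Fq] [CharP Fq p]
    (ξ : K Fq) (n : ℕ) (w : ℝ) (hw : 0 < w) (h : w ∈ wnSet Fq (ξ ^ p) n) :
    w ∈ wnSet Fq ξ n := by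
  have hp0 : p ≠ 0 := (Fact.out : p.Prime).ne_zero
  have hq := card_gt_one Fq
  intro hfin
  have hmin : ∃ ε : ℝ, 0 < ε ∧ ∀ Q : Polynomial (Polynomial Fq), Q.natDegree ≤ n →
      0 < absK Fq (evalK Fq Q ξ) → absK Fq (evalK Fq Q ξ) < HP Fq Q ^ (-w) →
      ε ≤ absK Fq (evalK Fq Q ξ) := by
    rcases Set.eq_empty_or_nonempty {P : Polynomial (Polynomial Fq) |
      P.natDegree ≤ n ∧ 0 < absK Fq (evalK Fq P ξ) ∧
      absK Fq (evalK Fq P ξ) < HP Fq P ^ (-w)} with he | he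
    · refine ⟨1, one_pos, fun Q h1 h2 h3 => ?_⟩
      exact absurd ⟨h1, h2, h3⟩ (Set.eq_empty_iff_forall_notMem.mp he Q)
    · obtain ⟨Q0, hQ0, hm⟩ := Set.exists_min_image _ (fun Q => absK Fq (evalK Fq Q ξ)) hfin he
      exact ⟨_, hQ0.2.1, fun Q h1 h2 h3 => hm Q ⟨h1, h2, h3⟩⟩
  obtain ⟨ε, hε, hmin⟩ := hmin
  -- heights are bounded
  have hlim : Filter.Tendsto (fun d : ℕ => ((Fintype.card Fq : ℝ) ^ d) ^ (-w)) Filter.atTop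
      (nhds 0) :=
    (tendsto_rpow_neg_atTop hw).comp (tendsto_pow_atTop_atTop_of_one_lt hq)
  obtain ⟨d, hd⟩ := Filter.eventually_atTop.mp (hlim.eventually (gt_mem_nhds (pow_pos hε p)))
  refine h ((finite_lh Fq n d).subset ?_)
  rintro P ⟨h1, h2, h3⟩
  refine ⟨h1, ?_⟩
  obtain ⟨Q, hQ1, hQ2, hQ3, hQ4⟩ := exists_sec p Fq P ξ ((absK_pos_iff _ _).mp h2)
  have hpos : 0 < HP Fq Q := zero_lt_one.trans_le (one_le_HP Fq Q)
  have hlt : absK Fq (evalK Fq Q ξ) < HP Fq Q ^ (-w) := by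
    refine lt_of_pow_lt_pow_left₀ p (Real.rpow_nonneg hpos.le _) ?_
    calc _ < HP Fq P ^ (-w) := hQ4.trans_lt h3
      _ ≤ (HP Fq Q ^ p) ^ (-w) := Real.rpow_le_rpow_of_nonpos (by positivity) hQ2 (by linarith)
      _ = (HP Fq Q ^ (-w)) ^ p := by
        rw [← Real.rpow_natCast, ← Real.rpow_natCast, ← Real.rpow_mul hpos.le,
          ← Real.rpow_mul hpos.le, mul_comm]
  have hge := hmin Q (hQ1.trans h1) ((absK_pos_iff _ _).mpr hQ3) hlt
  by_contra hc
  have h4 := hd (lh Fq P) (not_le.mp hc).le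
  rw [← HP_eq] at h4
  have h5 := pow_le_pow_left₀ hε.le hge p
  linarith

lemma wn_nonneg (Fq : Type) [Field Fq] [Fintype Fq] (ξ : K Fq) (n : ℕ) (hn : 1 ≤ n) :
    0 ≤ wn Fq ξ n := by
  refine le_of_forall_lt fun c hc => ?_
  obtain ⟨r, hr1, hr2⟩ := EReal.lt_iff_exists_real_btwn.mp hc
  refine hr1.trans_le (le_sSup ⟨r, neg_mem_wnSet Fq ξ n hn r (by exact_mod_cast hr2), rfl⟩)

/-- `w_n(ξ) = w_n(ξ^p)`. -/
theorem wn_frobenius (p : ℕ) [Fact p.Prime] (Fq : Type) [Field Fq] [Fintype Fq] [CharP Fq p]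
    (ξ : K Fq) (n : ℕ) (hn : 1 ≤ n) :
    wn Fq ξ n = wn Fq (ξ ^ p) n := by
  apply le_antisymm
  · refine sSup_le ?_
    rintro _ ⟨w, hw, rfl⟩
    rcases le_or_gt w 0 with h | h
    · exact le_trans (EReal.coe_nonpos.mpr h) (wn_nonneg Fq (ξ ^ p) n hn)
    · exact le_sSup ⟨w, mem_frob p Fq ξ n w h hw, rfl⟩
  · refine sSup_le ?_
    rintro _ ⟨w, hw, rfl⟩
    rcases le_or_gt w 0 with h | h
    · exact le_trans (EReal.coe_nonpos.mpr h) (wn_nonneg Fq ξ n hn)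
    · exact le_sSup ⟨w, mem_of_frob p Fq ξ n w h hw, rfl⟩

end
end MahlerKoksmaFq
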